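/- arXiv:1701.00354 — 3 statements merged into one kernel-verified Lean document; each statement's English description precedes it below -/
import Mathlib

section
/- Let (Ω, 𝒜, ℙ) be a probability space and let S, T : Ω → Ω be commuting measure-preserving maps. Suppose g : Ω → ℝ is measurable, there exists λ > 1 with λ⁻¹ ≤ g ≤ λ ℙ-a.e., and 𝔼(g | 𝒜₁) = 𝔼(g | 𝒜₂) = 1 ℙ-a.e., where 𝒜₁, 𝒜₂ are the sub-σ-algebras of S-invariant and T-invariant sets. Then for every ε ∈ (0,1) there exists n₀ such that for every n ≥ n₀ there is a measurable set ℰ_n ⊆ Ω with ℙ(ℰ_n) ≤ 2ε² such that for every ω ∉ ℰ_n: the number of indices k ∈ {0,…,n−1} for which the k-th column sum ∑_{i=0}^{n−1} g(S^i(T^k(ω))) lies outside [(1−ε)n, (1+ε)n] is at most εn, and the number of indices k ∈ {0,…,n−1} for which the k-th row sum ∑_{j=0}^{n−1} g(S^k(T^j(ω))) lies outside [(1−ε)n, (1+ε)n] is at most εn. -/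
open MeasureTheory Filter

noncomputable section

/-- The sub-σ-algebra of `S`-invariant (measurable) sets. -/
def invSigma {Ω : Type*} [MeasurableSpace Ω] (S : Ω → Ω) : MeasurableSpace Ω where
  MeasurableSet' A := MeasurableSet A ∧ S ⁻¹' A = A
  measurableSet_empty := ⟨MeasurableSet.empty, rfl⟩
  measurableSet_compl A hA := ⟨hA.1.compl, by rw [Set.preimage_compl, hA.2]⟩
  measurableSet_iUnion f hf := ⟨MeasurableSet.iUnion fun i => (hf i).1, by
    rw [Set.preimage_iUnion]
    exact Set.iUnion_congr fun i => (hf i).2⟩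

open scoped Topology ENNReal

section MeanErgodic

variable {Ω : Type*} [MeasurableSpace Ω] {P : Measure Ω} {S : Ω → Ω}

/-- An almost everywhere `S`-invariant function is almost everywhere equal to a function measurable
with respect to the `S`-invariant sets. -/
theorem aestronglyMeasurable_invSigma (hS : MeasurePreserving S P P) {h : Ω → ℝ}
    (hm : AEStronglyMeasurable h P) (hinv : h ∘ S =ᵐ[P] h) :
    AEStronglyMeasurable[invSigma S] h P := by
  have hk : hm.aemeasurable.mk h =ᵐ[P] h := hm.aemeasurable.ae_eq_mk.symm
  have hkm : Measurable (hm.aemeasurable.mk h) := hm.aemeasurable.measurable_mk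
  set k := hm.aemeasurable.mk h
  have hiter : ∀ᵐ ω ∂P, ∀ n : ℕ, k (S^[n] ω) = h ω := by
    refine ae_all_iff.2 fun n => ?_
    induction n with
    | zero => exact hk
    | succ n ih =>
      filter_upwards [hS.quasiMeasurePreserving.ae ih, hinv] with ω h₁ h₂
      rw [Function.iterate_succ_apply, h₁]
      exact h₂
  let u : Ω → EReal := fun ω => limsup (fun n : ℕ => (k (S^[n] ω) : EReal)) atTop
  have hu : Measurable u := Measurable.limsup fun n =>
    measurable_coe_real_ereal.comp (hkm.comp (hS.measurable.iterate n))
  have huS : u ∘ S = u := by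
    funext ω
    exact limsup_nat_add (fun n : ℕ => (k (S^[n] ω) : EReal)) 1
  have huI : Measurable[invSigma S] u := fun s hs =>
    ⟨hu hs, by rw [← Set.preimage_comp, huS]⟩
  refine ⟨fun ω => (u ω).toReal, (measurable_ereal_toReal.comp huI).stronglyMeasurable, ?_⟩
  filter_upwards [hiter] with ω hω
  simp [u, hω]

theorem invSigma_le (S : Ω → Ω) : invSigma S ≤ ‹MeasurableSpace Ω› := fun _ hA => hA.1

theorem integral_mul_eq_zero_of_condExp_invSigma_eq_zero [IsProbabilityMeasure P]
    (hS : MeasurePreserving S P P) {f h : Ω → ℝ} (hf : MemLp f 2 P) (hh : MemLp h 2 P)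
    (hf0 : P[f | invSigma S] =ᵐ[P] 0) (hinv : h ∘ S =ᵐ[P] h) : ∫ ω, h ω * f ω ∂P = 0 := by
  have h₁ := condExp_mul_of_aestronglyMeasurable_left
    (aestronglyMeasurable_invSigma hS hh.aestronglyMeasurable hinv)
    (hh.integrable_mul hf) (hf.integrable (by norm_num))
  have h₂ : P[h * f | invSigma S] =ᵐ[P] 0 := by
    filter_upwards [h₁, hf0] with ω h₁ h₂
    simp [h₁, h₂]
  have h₃ := integral_condExp (μ := P) (f := h * f) (invSigma_le S)
  rw [integral_congr_ae h₂] at h₃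
  simpa using h₃.symm

theorem birkhoffAverage_toLp_ae_eq [IsProbabilityMeasure P] (hS : MeasurePreserving S P P)
    {f : Ω → ℝ} (hf : MemLp f 2 P) (n : ℕ) :
    (birkhoffAverage ℝ (Lp.compMeasurePreservingₗᵢ ℝ S hS) id n (hf.toLp f) : Lp ℝ 2 P) =ᵐ[P]
      birkhoffAverage ℝ S f n := by
  have hi : ∀ i, (Lp.compMeasurePreservingₗᵢ (E := ℝ) (p := 2) ℝ S hS)^[i] (hf.toLp f) =
      (hf.comp_measurePreserving (hS.iterate i)).toLp (f ∘ S^[i]) := fun i => by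
    induction i with
    | zero => rfl
    | succ i ih =>
      rw [Function.iterate_succ_apply', ih]
      rfl
  have hsum : ⇑(∑ i ∈ Finset.range n,
      (hf.comp_measurePreserving (hS.iterate i)).toLp (f ∘ S^[i])) =ᵐ[P]
        fun ω => ∑ i ∈ Finset.range n, f (S^[i] ω) := by
    induction n with
    | zero =>
      simp only [Finset.range_zero, Finset.sum_empty]
      exact Lp.coeFn_zero ℝ 2 P
    | succ n ih =>
      simp only [Finset.sum_range_succ]
      filter_upwards [Lp.coeFn_add (∑ i ∈ Finset.range n,
        (hf.comp_measurePreserving (hS.iterate i)).toLp (f ∘ S^[i]))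
        ((hf.comp_measurePreserving (hS.iterate n)).toLp (f ∘ S^[n])), ih,
        (hf.comp_measurePreserving (hS.iterate n)).coeFn_toLp] with ω h₁ h₂ h₃
      rw [h₁, Pi.add_apply, h₂, h₃]
      rfl
  simp only [birkhoffAverage, birkhoffSum, id, hi]
  filter_upwards [Lp.coeFn_smul (n : ℝ)⁻¹ (∑ i ∈ Finset.range n,
    (hf.comp_measurePreserving (hS.iterate i)).toLp (f ∘ S^[i])), hsum] with ω h₁ h₂
  rw [h₁, Pi.smul_apply, h₂]
  rfl

/-- The mean ergodic theorem for a function with vanishing conditional expectation on the invariant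
sets, with convergence in measure. -/
theorem tendstoInMeasure_birkhoffAverage_zero [IsProbabilityMeasure P]
    (hS : MeasurePreserving S P P) {f : Ω → ℝ} (hf : MemLp f 2 P)
    (hf0 : P[f | invSigma S] =ᵐ[P] 0) :
    TendstoInMeasure P (birkhoffAverage ℝ S f) atTop 0 := by
  let U := (Lp.compMeasurePreservingₗᵢ (E := ℝ) (p := 2) ℝ S hS).toContinuousLinearMap
  have hlim := U.tendsto_birkhoffAverage_orthogonalProjection
    (LinearIsometry.norm_toContinuousLinearMap_le _) (hf.toLp f)
  have hproj : (U.eqLocus (1 : Lp ℝ 2 P →L[ℝ] Lp ℝ 2 P)).orthogonalProjectionOnto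
      (hf.toLp f) = 0 := by
    rw [Submodule.orthogonalProjectionOnto_eq_zero_iff]
    intro h hh
    have hinv : (h : Ω → ℝ) ∘ S =ᵐ[P] h :=
      (Lp.coeFn_compMeasurePreserving h hS).symm.trans
        (congrArg (fun v : Lp ℝ 2 P => (v : Ω → ℝ)) hh).eventuallyEq
    rw [L2.inner_def, ← integral_mul_eq_zero_of_condExp_invSigma_eq_zero hS hf (Lp.memLp h) hf0
      hinv]
    refine integral_congr_ae ?_
    filter_upwards [hf.coeFn_toLp] with ω hω
    simp [hω, mul_comm]
  rw [hproj, ZeroMemClass.coe_zero] at hlim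
  exact (tendstoInMeasure_of_tendsto_Lp hlim).congr
    (fun n => birkhoffAverage_toLp_ae_eq hS hf n) (Lp.coeFn_zero ℝ 2 P)

theorem eventually_measure_birkhoffSum_notMem_le [IsProbabilityMeasure P]
    (hS : MeasurePreserving S P P) {g : Ω → ℝ} (hg : MemLp g 2 P)
    (hg1 : P[g | invSigma S] =ᵐ[P] fun _ => 1) {ε : ℝ} (hε : 0 < ε) {δ : ℝ≥0∞} (hδ : 0 < δ) :
    ∀ᶠ n : ℕ in atTop, P {ω | ¬((1 - ε) * n ≤ ∑ i ∈ Finset.range n, g (S^[i] ω) ∧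
      ∑ i ∈ Finset.range n, g (S^[i] ω) ≤ (1 + ε) * n)} ≤ δ := by
  have hf : MemLp (fun ω => g ω - 1) 2 P := hg.sub (memLp_const 1)
  have hf0 : P[fun ω => g ω - 1 | invSigma S] =ᵐ[P] 0 := by
    have h := condExp_sub (hg.integrable (by norm_num)) (integrable_const (1 : ℝ)) (invSigma S)
    rw [condExp_const (invSigma_le S)] at h
    filter_upwards [h, hg1] with ω h₁ h₂
    exact h₁.trans (by simp [h₂])
  have h := tendstoInMeasure_iff_norm.1 (tendstoInMeasure_birkhoffAverage_zero hS hf hf0) ε hε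
  filter_upwards [ENNReal.tendsto_nhds_zero.1 h δ hδ, eventually_gt_atTop 0] with n hn hn0
  refine (measure_mono fun ω hω => ?_).trans hn
  have hn0' : (0 : ℝ) < n := Nat.cast_pos.2 hn0
  simp only [Set.mem_ofPred_eq] at hω ⊢
  contrapose! hω
  simp only [birkhoffAverage, birkhoffSum, Finset.sum_sub_distrib, Finset.sum_const,
    Finset.card_range, nsmul_eq_mul, mul_one, smul_eq_mul, Pi.zero_apply, sub_zero,
    Real.norm_eq_abs, abs_lt, inv_mul_eq_div, lt_div_iff₀ hn0', div_lt_iff₀ hn0'] at hω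
  constructor <;> linarith [hω.1, hω.2]

end MeanErgodic

open Classical in
/-- If `B` has small measure, then most orbits of length `n` visit `B` rarely. -/
theorem measure_card_visits_gt_le {Ω : Type*} [MeasurableSpace Ω] {P : Measure Ω} {T : Ω → Ω}
    (hT : MeasurePreserving T P P) {B : Set Ω} (hB : MeasurableSet B) {ε : ℝ} (hε : 0 < ε)
    (hPB : P B ≤ ENNReal.ofReal (ε ^ 3)) (n : ℕ) :
    ∃ E : Set Ω, MeasurableSet E ∧ P E ≤ ENNReal.ofReal (ε ^ 2) ∧
      ∀ ω, ω ∉ E → (((Finset.range n).filter fun k => T^[k] ω ∈ B).card : ℝ) ≤ ε * n := by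
  rcases n.eq_zero_or_pos with rfl | hn
  · exact ⟨∅, MeasurableSet.empty, by simp, by simp⟩
  let F : Ω → ℝ≥0∞ := fun ω => ∑ k ∈ Finset.range n, B.indicator 1 (T^[k] ω)
  have hBk : ∀ k, Measurable fun ω => B.indicator (1 : Ω → ℝ≥0∞) (T^[k] ω) := fun k =>
    (measurable_one.indicator hB).comp (hT.measurable.iterate k)
  have hF : Measurable F := Finset.measurable_fun_sum _ fun k _ => hBk k
  have hFcard : ∀ ω, F ω = (((Finset.range n).filter fun k => T^[k] ω ∈ B).card : ℝ≥0∞) := by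
    intro ω
    simp [F, Set.indicator_apply]
  have hFint : ∫⁻ ω, F ω ∂P = n * P B := by
    rw [lintegral_finsetSum _ fun k _ => hBk k]
    have : ∀ k, ∫⁻ ω, B.indicator (1 : Ω → ℝ≥0∞) (T^[k] ω) ∂P = P B := fun k => by
      rw [(hT.iterate k).lintegral_comp (measurable_one.indicator hB), lintegral_indicator_one hB]
    simp [this]
  have hn0 : (0 : ℝ) < n := Nat.cast_pos.2 hn
  refine ⟨{ω | ENNReal.ofReal (ε * n) ≤ F ω}, measurableSet_le measurable_const hF, ?_, ?_⟩
  · have hM := mul_meas_ge_le_lintegral (μ := P) hF (ENNReal.ofReal (ε * n))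
    have hc : ENNReal.ofReal (ε * n) ≠ 0 := by simpa using mul_pos hε hn0
    rw [← ENNReal.mul_le_mul_iff_right hc ENNReal.ofReal_ne_top]
    refine hM.trans (hFint.trans_le ?_)
    calc (n : ℝ≥0∞) * P B ≤ ENNReal.ofReal n * ENNReal.ofReal (ε ^ 3) := by
          rw [ENNReal.ofReal_natCast]; gcongr
      _ = ENNReal.ofReal (ε * n) * ENNReal.ofReal (ε ^ 2) := by
          rw [← ENNReal.ofReal_mul hn0.le, ← ENNReal.ofReal_mul (by positivity)]
          congr 1
          ring
  · intro ω hω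
    simp only [Set.mem_ofPred_eq, not_le, hFcard] at hω
    rw [← ENNReal.ofReal_natCast, ENNReal.ofReal_lt_ofReal_iff (by positivity)] at hω
    exact hω.le

/-- most row and column sums of `□_n g(ω)` are asymptotically `n`. -/
theorem approx_doubly_stochastic_rows_cols
    {Ω : Type*} [MeasurableSpace Ω] (P : Measure Ω) [IsProbabilityMeasure P]
    (S T : Ω → Ω) (hS : MeasurePreserving S P P) (hT : MeasurePreserving T P P)
    (hST : S ∘ T = T ∘ S)
    (g : Ω → ℝ) (hg : Measurable g)
    (lam : ℝ) (hlam : 1 < lam) (hbd : ∀ᵐ ω ∂P, lam⁻¹ ≤ g ω ∧ g ω ≤ lam)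
    (hds1 : P[g | invSigma S] =ᵐ[P] fun _ => 1)
    (hds2 : P[g | invSigma T] =ᵐ[P] fun _ => 1) :
    ∀ ε : ℝ, 0 < ε → ε < 1 → ∃ n₀ : ℕ, ∀ n : ℕ, n₀ ≤ n →
      ∃ E : Set Ω, MeasurableSet E ∧ P E ≤ ENNReal.ofReal (2 * ε ^ 2) ∧
        ∀ ω, ω ∉ E →
          (((Finset.range n).filter fun k =>
              ¬((1 - ε) * n ≤ ∑ i ∈ Finset.range n, g (S^[i] (T^[k] ω)) ∧
                (∑ i ∈ Finset.range n, g (S^[i] (T^[k] ω))) ≤ (1 + ε) * n)).card : ℝ)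
            ≤ ε * n ∧
          (((Finset.range n).filter fun k =>
              ¬((1 - ε) * n ≤ ∑ j ∈ Finset.range n, g (S^[k] (T^[j] ω)) ∧
                (∑ j ∈ Finset.range n, g (S^[k] (T^[j] ω))) ≤ (1 + ε) * n)).card : ℝ)
            ≤ ε * n := by
  intro ε hε _
  have hmem : MemLp g 2 P := by
    refine MemLp.of_bound hg.aestronglyMeasurable lam ?_
    filter_upwards [hbd] with ω hω
    rw [Real.norm_eq_abs, abs_le]
    have : 0 < lam⁻¹ := inv_pos.2 (by linarith)
    exact ⟨by linarith [hω.1], hω.2⟩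
  have hδ : 0 < ENNReal.ofReal (ε ^ 3) := ENNReal.ofReal_pos.2 (by positivity)
  obtain ⟨n₀, hn₀⟩ := eventually_atTop.1
    ((eventually_measure_birkhoffSum_notMem_le hS hmem hds1 hε hδ).and
      (eventually_measure_birkhoffSum_notMem_le hT hmem hds2 hε hδ))
  refine ⟨n₀, fun n hn => ?_⟩
  have hmeas : ∀ R : Ω → Ω, Measurable R →
      MeasurableSet {ω | ¬((1 - ε) * n ≤ ∑ i ∈ Finset.range n, g (R^[i] ω) ∧
        ∑ i ∈ Finset.range n, g (R^[i] ω) ≤ (1 + ε) * n)} := fun R hR => by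
    have hsum : Measurable fun ω => ∑ i ∈ Finset.range n, g (R^[i] ω) :=
      Finset.measurable_fun_sum _ fun i _ => hg.comp (hR.iterate i)
    exact ((measurableSet_le measurable_const hsum).inter
      (measurableSet_le hsum measurable_const)).compl
  obtain ⟨E₁, hE₁, hPE₁, hE₁card⟩ :=
    measure_card_visits_gt_le hT (hmeas S hS.measurable) hε (hn₀ n hn).1 n
  obtain ⟨E₂, hE₂, hPE₂, hE₂card⟩ :=
    measure_card_visits_gt_le hS (hmeas T hT.measurable) hε (hn₀ n hn).2 n
  have hcommute : Function.Commute S T := congrFun hST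
  have hcomm : ∀ k j ω, S^[k] (T^[j] ω) = T^[j] (S^[k] ω) := fun k j ω =>
    hcommute.iterate_iterate k j ω
  refine ⟨E₁ ∪ E₂, hE₁.union hE₂, ?_, fun ω hω => ?_⟩
  · refine (measure_union_le _ _).trans ((add_le_add hPE₁ hPE₂).trans_eq ?_)
    rw [← ENNReal.ofReal_add (by positivity) (by positivity), two_mul]
  · rw [Set.mem_union, not_or] at hω
    refine ⟨?_, ?_⟩
    · convert hE₁card ω hω.1 using 3
      ext k
      simp only [Finset.mem_filter, Set.mem_ofPred_eq]
    · simp only [hcomm]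
      convert hE₂card ω hω.2 using 3
      ext k
      simp only [Finset.mem_filter, Set.mem_ofPred_eq]
end
end

section
/- Let λ ≥ 1 and let X_n = (x_{ij}) and Y_n = (y_{ij}) be n×n real matrices with λ⁻¹ ≤ x_{ij} ≤ λ and λ⁻¹ ≤ y_{ij} ≤ λ for all i, j. Then |log(per(X_n)/per(Y_n))| ≤ (λ⁵/n²) ∑_{1≤i,j≤n} |x_{ij} − y_{ij}|. -/
noncomputable section

/-- The permanent of an `n × n` real matrix. -/
def permanent {n : ℕ} (M : Matrix (Fin n) (Fin n) ℝ) : ℝ :=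
  ∑ π : Equiv.Perm (Fin n), ∏ i, M i (π i)

/-- The permanental mean `per(M) = (perm(M)/n!)^{1/n}`. -/
def permMean {n : ℕ} (M : Matrix (Fin n) (Fin n) ℝ) : ℝ :=
  (permanent M / (Nat.factorial n)) ^ ((n : ℝ)⁻¹)

open Finset in
/-- Composing `π` with a transposition changes at most two factors of `∏ l, M l (π l)`. -/
lemma prod_erase_le_prod_mul_swap {n : ℕ} {lam : ℝ} (hlam : 1 ≤ lam)
    {M : Matrix (Fin n) (Fin n) ℝ} (hM : ∀ i j, lam⁻¹ ≤ M i j ∧ M i j ≤ lam)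
    (i k : Fin n) (π : Equiv.Perm (Fin n)) :
    ∏ l ∈ univ.erase i, M l (π l) ≤ lam ^ 3 * ∏ l, M l ((π * Equiv.swap i k) l) := by
  have h0 : 0 < lam := by linarith
  have hpos : ∀ i j, 0 < M i j := fun i j => (inv_pos.2 h0).trans_le (hM i j).1
  have hone : ∀ i j, 1 ≤ lam * M i j := fun i j => by
    have := mul_le_mul_of_nonneg_left (hM i j).1 h0.le
    rwa [mul_inv_cancel₀ h0.ne'] at this
  rw [← mul_prod_erase univ _ (mem_univ i)]
  by_cases hk : k = i
  · subst hk
    have hP : 0 ≤ ∏ l ∈ univ.erase k, M l (π l) := prod_nonneg fun l _ => (hpos _ _).le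
    have h : 1 ≤ lam ^ 2 * (lam * M k (π k)) :=
      one_le_mul_of_one_le_of_one_le (one_le_pow₀ hlam) (hone _ _)
    simp only [Equiv.swap_self, Equiv.Perm.mul_apply, Equiv.refl_apply]
    nlinarith [mul_le_mul_of_nonneg_right h hP]
  · have hmem : k ∈ univ.erase i := mem_erase.2 ⟨hk, mem_univ k⟩
    rw [← mul_prod_erase _ _ hmem, ← mul_prod_erase _ _ hmem]
    have hrest : ∏ l ∈ (univ.erase i).erase k, M l ((π * Equiv.swap i k) l) =
        ∏ l ∈ (univ.erase i).erase k, M l (π l) := by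
      refine prod_congr rfl fun l hl => ?_
      simp only [mem_erase, mem_univ, and_true] at hl
      rw [Equiv.Perm.mul_apply, Equiv.swap_apply_of_ne_of_ne hl.2 hl.1]
    rw [hrest, Equiv.Perm.mul_apply, Equiv.Perm.mul_apply, Equiv.swap_apply_left,
      Equiv.swap_apply_right]
    have hP : 0 ≤ ∏ l ∈ (univ.erase i).erase k, M l (π l) :=
      prod_nonneg fun l _ => (hpos _ _).le
    have h : M k (π k) ≤ lam * ((lam * M i (π k)) * (lam * M k (π i))) :=
      (hM _ _).2.trans (le_mul_of_one_le_right h0.le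
        (one_le_mul_of_one_le_of_one_le (hone _ _) (hone _ _)))
    calc _ ≤ _ := mul_le_mul_of_nonneg_right h hP
      _ = _ := by ring

open Finset in
/-- The permanent of the `(i, j)` minor of `M`, as a sum over permutations with `π i = j`. -/
def permanentMinor {n : ℕ} (M : Matrix (Fin n) (Fin n) ℝ) (i j : Fin n) : ℝ :=
  ∑ π : Equiv.Perm (Fin n), if π i = j then ∏ l ∈ univ.erase i, M l (π l) else 0

open Finset in
lemma permanent_eq_sum_mul_permanentMinor {n : ℕ} (M : Matrix (Fin n) (Fin n) ℝ) (i : Fin n) :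
    permanent M = ∑ j, M i j * permanentMinor M i j := by
  simp only [permanent, permanentMinor, mul_sum]
  rw [sum_comm]
  refine sum_congr rfl fun π _ => ?_
  simp only [mul_ite, mul_zero, sum_ite_eq, mem_univ, if_true]
  exact (mul_prod_erase univ (fun l => M l (π l)) (mem_univ i)).symm

open Finset in
lemma permanentMinor_congr {n : ℕ} {M N : Matrix (Fin n) (Fin n) ℝ} {i : Fin n}
    (h : ∀ l, l ≠ i → M l = N l) (j : Fin n) : permanentMinor M i j = permanentMinor N i j := by
  refine sum_congr rfl fun π _ => ?_
  rw [prod_congr rfl fun l hl => by rw [h l (ne_of_mem_erase hl)]]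

open Finset in
lemma card_mul_permanentMinor_le {n : ℕ} {lam : ℝ} (hlam : 1 ≤ lam)
    {M : Matrix (Fin n) (Fin n) ℝ} (hM : ∀ i j, lam⁻¹ ≤ M i j ∧ M i j ≤ lam) (i j : Fin n) :
    n * permanentMinor M i j ≤ lam ^ 3 * permanent M := by
  have key : ∀ k : Fin n, permanentMinor M i j ≤
      lam ^ 3 * ∑ π : Equiv.Perm (Fin n), if π k = j then ∏ l, M l (π l) else 0 := fun k => by
    rw [← Equiv.sum_comp (Equiv.mulRight (Equiv.swap i k)), mul_sum]
    refine sum_le_sum fun π _ => ?_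
    simp only [Equiv.coe_mulRight, Equiv.Perm.mul_apply, Equiv.swap_apply_right]
    split_ifs
    · exact prod_erase_le_prod_mul_swap hlam hM i k π
    · simp
  have hsum := sum_le_sum fun k (_ : k ∈ univ) => key k
  rw [sum_const, card_univ, Fintype.card_fin, nsmul_eq_mul, ← mul_sum, sum_comm] at hsum
  refine hsum.trans_eq ?_
  congr 1
  refine sum_congr rfl fun π _ => ?_
  rw [← Equiv.sum_comp π.symm]
  simp

lemma permanent_pos {n : ℕ} {M : Matrix (Fin n) (Fin n) ℝ} (hM : ∀ i j, 0 < M i j) :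
    0 < permanent M :=
  Finset.sum_pos (fun _ _ => Finset.prod_pos fun _ _ => hM _ _) Finset.univ_nonempty

open Finset in
lemma log_permanent_sub_le_of_row {n : ℕ} {lam : ℝ} (hlam : 1 ≤ lam)
    {M N : Matrix (Fin n) (Fin n) ℝ} (hM : ∀ i j, lam⁻¹ ≤ M i j ∧ M i j ≤ lam)
    (hN : ∀ i j, lam⁻¹ ≤ N i j ∧ N i j ≤ lam) {i : Fin n} (h : ∀ l, l ≠ i → M l = N l) :
    Real.log (permanent M) - Real.log (permanent N) ≤
      lam ^ 3 / n * ∑ j, |M i j - N i j| := by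
  have h0 : 0 < lam⁻¹ := inv_pos.2 (by linarith)
  have hMp := permanent_pos fun i j => h0.trans_le (hM i j).1
  have hNp := permanent_pos fun i j => h0.trans_le (hN i j).1
  have hn : (0 : ℝ) < n := by exact_mod_cast i.pos
  rw [← Real.log_div hMp.ne' hNp.ne']
  refine (Real.log_le_sub_one_of_pos (div_pos hMp hNp)).trans ?_
  rw [div_sub_one hNp.ne', div_le_iff₀ hNp, permanent_eq_sum_mul_permanentMinor M i]
  nth_rw 1 [permanent_eq_sum_mul_permanentMinor N i]
  rw [← sum_sub_distrib, mul_sum, sum_mul]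
  refine sum_le_sum fun j _ => ?_
  have hminor : 0 ≤ permanentMinor N i j := by
    refine sum_nonneg fun π _ => ?_
    split_ifs
    · exact prod_nonneg fun l _ => h0.le.trans (hN _ _).1
    · rfl
  have hle : permanentMinor N i j ≤ lam ^ 3 / n * permanent N := by
    rw [div_mul_eq_mul_div, le_div_iff₀' hn]
    exact card_mul_permanentMinor_le hlam hN i j
  rw [permanentMinor_congr h, ← sub_mul]
  calc _ ≤ |M i j - N i j| * permanentMinor N i j :=
        mul_le_mul_of_nonneg_right (le_abs_self _) hminor
    _ ≤ |M i j - N i j| * (lam ^ 3 / n * permanent N) :=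
        mul_le_mul_of_nonneg_left hle (abs_nonneg _)
    _ = _ := by ring

open Finset in
lemma log_permanent_sub_le {n : ℕ} {lam : ℝ} (hlam : 1 ≤ lam)
    {X Y : Matrix (Fin n) (Fin n) ℝ} (hX : ∀ i j, lam⁻¹ ≤ X i j ∧ X i j ≤ lam)
    (hY : ∀ i j, lam⁻¹ ≤ Y i j ∧ Y i j ≤ lam) :
    Real.log (permanent X) - Real.log (permanent Y) ≤
      lam ^ 3 / n * ∑ i, ∑ j, |X i j - Y i j| := by
  let Z : Finset (Fin n) → Matrix (Fin n) (Fin n) ℝ := fun S i => if i ∈ S then X i else Y i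
  have hZ : ∀ S i j, lam⁻¹ ≤ Z S i j ∧ Z S i j ≤ lam := fun S i j => by
    simp only [Z]
    split_ifs
    exacts [hX i j, hY i j]
  have key : ∀ S, Real.log (permanent (Z S)) - Real.log (permanent Y) ≤
      lam ^ 3 / n * ∑ i ∈ S, ∑ j, |X i j - Y i j| := fun S => by
    induction S using Finset.induction_on with
    | empty =>
      have : Z ∅ = Y := by ext; simp [Z]
      simp [this]
    | insert a S ha ih =>
      have hrow := log_permanent_sub_le_of_row hlam (hZ (insert a S)) (hZ S) (i := a)
        fun l hl => by simp [Z, hl]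
      have hXa : Z (insert a S) a = X a := by simp [Z]
      have hYa : Z S a = Y a := by simp [Z, ha]
      rw [hXa, hYa] at hrow
      rw [sum_insert ha, mul_add]
      linarith
  have : Z univ = X := by ext; simp [Z]
  simpa only [this] using key univ

lemma log_permMean {n : ℕ} {M : Matrix (Fin n) (Fin n) ℝ} (hM : 0 < permanent M) :
    Real.log (permMean M) =
      (n : ℝ)⁻¹ * (Real.log (permanent M) - Real.log (Nat.factorial n)) := by
  have hf : (0 : ℝ) < Nat.factorial n := by exact_mod_cast n.factorial_pos
  rw [permMean, Real.log_rpow (div_pos hM hf), Real.log_div hM.ne' hf.ne']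

lemma permMean_pos {n : ℕ} {M : Matrix (Fin n) (Fin n) ℝ} (hM : 0 < permanent M) :
    0 < permMean M :=
  Real.rpow_pos_of_pos (div_pos hM (by exact_mod_cast n.factorial_pos)) _

/-- `L¹`-continuity of the permanental mean for matrices with entries in
`[λ⁻¹, λ]`. -/
theorem permMean_L1_continuity (lam : ℝ) (hlam : 1 ≤ lam) (n : ℕ)
    (X Y : Matrix (Fin n) (Fin n) ℝ)
    (hX : ∀ i j, lam⁻¹ ≤ X i j ∧ X i j ≤ lam)
    (hY : ∀ i j, lam⁻¹ ≤ Y i j ∧ Y i j ≤ lam) :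
    |Real.log (permMean X / permMean Y)| ≤
      lam ^ 5 / (n : ℝ) ^ 2 * ∑ i, ∑ j, |X i j - Y i j| := by
  have h0 : 0 < lam⁻¹ := inv_pos.2 (by linarith)
  have hXp := permanent_pos fun i j => h0.trans_le (hX i j).1
  have hYp := permanent_pos fun i j => h0.trans_le (hY i j).1
  have hXY := log_permanent_sub_le hlam hX hY
  have hYX := log_permanent_sub_le hlam hY hX
  simp only [abs_sub_comm (Y _ _)] at hYX
  rw [Real.log_div (permMean_pos hXp).ne' (permMean_pos hYp).ne', log_permMean hXp,
    log_permMean hYp, ← mul_sub, sub_sub_sub_cancel_right, abs_mul,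
    abs_of_nonneg (by positivity : (0 : ℝ) ≤ (n : ℝ)⁻¹)]
  calc _ ≤ (n : ℝ)⁻¹ * (lam ^ 3 / n * ∑ i, ∑ j, |X i j - Y i j|) :=
        mul_le_mul_of_nonneg_left (abs_sub_le_iff.2 ⟨hXY, hYX⟩) (by positivity)
    _ = lam ^ 3 / (n : ℝ) ^ 2 * ∑ i, ∑ j, |X i j - Y i j| := by
        rw [div_eq_mul_inv, div_eq_mul_inv, sq, mul_inv]
        ring
    _ ≤ _ := by
        gcongr
        norm_num
end
end

section
/- Let λ > 1 and let (A_n)_{n≥1} be a sequence of matrices, where A_n = (a_{ij}) is an n×n matrix with A_n ∈ n·Ω_n and λ⁻¹ ≤ a_{ij} ≤ λ for all 1 ≤ i, j ≤ n. Then lim_{n→∞} per(A_n) = 1. -/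
open Filter

noncomputable section

open Polynomial in
/-- A Gauss–Lucas type statement: a nonconstant polynomial with all roots in the open lower
half-plane has nonvanishing derivative at `0`. -/
theorem eval_zero_derivative_ne_zero {p : ℂ[X]} (hdeg : 0 < p.natDegree)
    (hp : ∀ t : ℂ, 0 ≤ t.im → p.eval t ≠ 0) : p.derivative.eval 0 ≠ 0 := by
  have hs : p.Splits := IsAlgClosed.splits p
  have h0 : p.eval 0 ≠ 0 := hp 0 le_rfl
  have hroot : ∀ r ∈ p.roots, r.im < 0 := fun r hr => by
    by_contra! h
    exact hp r h (Polynomial.isRoot_of_mem_roots hr)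
  have key := hs.eval_derivative_div_eval_of_ne_zero h0
  intro hd
  rw [hd, zero_div] at key
  have him : ∀ r ∈ p.roots, (1 / (0 - r)).im < 0 := fun r hr => by
    have hr' := hroot r hr
    have hr0 : r ≠ 0 := by rintro rfl; simp at hr'
    rw [zero_sub, one_div, Complex.inv_im, Complex.neg_im, neg_neg, Complex.normSq_neg]
    exact div_neg_of_neg_of_pos hr' (Complex.normSq_pos.2 hr0)
  have hcard : 0 < p.roots.card := by rwa [← hs.natDegree_eq_card_roots]
  have hlt : (p.roots.map fun r => (1 / (0 - r)).im).sum < 0 := by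
    have := Multiset.sum_lt_sum_of_nonempty (s := p.roots) (f := fun r => (1 / (0 - r)).im)
      (g := fun _ => (0 : ℝ)) (by rintro h; simp [h] at hcard) him
    simpa using this
  have hsum : ((p.roots.map fun r => 1 / (0 - r)).sum).im
      = (p.roots.map fun r => (1 / (0 - r)).im).sum := by
    have := (Complex.imAddGroupHom).map_multiset_sum (p.roots.map fun r => 1 / (0 - r))
    simpa [Multiset.map_map, Function.comp_def] using this
  rw [← hsum, ← key] at hlt
  simp at hlt

open Polynomial in
theorem norm_eval_eq_mul_prod_roots {p : ℂ[X]} (hp : ∀ r ∈ p.roots, r.im = 0 ∧ r.re < 0)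
    {t : ℝ} (ht : 0 ≤ t) :
    ‖p.eval (t : ℂ)‖ = ‖p.eval 0‖ * (p.roots.map fun r => 1 + t * (-r.re)⁻¹).prod := by
  have hs : p.Splits := IsAlgClosed.splits p
  have hn : ∀ s : Multiset ℂ, (∀ r ∈ s, r.im = 0 ∧ r.re < 0) →
      ‖(s.map fun r => (t : ℂ) - r).prod‖
        = ‖(s.map fun r => (0 : ℂ) - r).prod‖ * (s.map fun r => 1 + t * (-r.re)⁻¹).prod := by
    intro s
    induction s using Multiset.induction_on with
    | empty => simp
    | cons r s ih =>
      intro h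
      obtain ⟨him, hre⟩ := h r (Multiset.mem_cons_self r s)
      have hr : r = (r.re : ℂ) := Complex.ext rfl (by simpa using him)
      have hfac : ‖(t : ℂ) - r‖ = ‖(0 : ℂ) - r‖ * (1 + t * (-r.re)⁻¹) := by
        rw [hr, zero_sub, norm_neg, ← Complex.ofReal_sub, Complex.norm_real, Complex.norm_real,
          Complex.ofReal_re, Real.norm_eq_abs, Real.norm_eq_abs, abs_of_neg hre,
          abs_of_pos (by linarith)]
        have : r.re ≠ 0 := hre.ne
        field_simp
        ring
      simp only [Multiset.map_cons, Multiset.prod_cons, norm_mul]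
      rw [hfac, ih fun r hr => h r (Multiset.mem_cons_of_mem hr)]
      ring
  rw [hs.eval_eq_prod_roots, hs.eval_eq_prod_roots, norm_mul, norm_mul, hn _ hp, mul_assoc]

open Polynomial in
theorem eval_zero_derivative_div_eval {p : ℂ[X]} (h0 : p.eval 0 ≠ 0)
    (hp : ∀ r ∈ p.roots, r.im = 0 ∧ r.re < 0) :
    p.derivative.eval 0 / p.eval 0 = ((p.roots.map fun r => (-r.re)⁻¹).sum : ℝ) := by
  rw [(IsAlgClosed.splits p).eval_derivative_div_eval_of_ne_zero h0]
  rw [← Complex.ofRealHom_eq_coe, map_multiset_sum, Multiset.map_map]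
  congr 1
  refine Multiset.map_congr rfl fun r hr => ?_
  have hr' : r = (r.re : ℂ) := Complex.ext rfl (by simpa using (hp r hr).1)
  rw [hr']
  simp

open Polynomial in
/-- A polynomial whose roots are all real and negative is log-concave on the positive axis, so it
lies below the exponential of its tangent at `0`. -/
theorem norm_eval_le_mul_exp {p : ℂ[X]} (hp : ∀ r ∈ p.roots, r.im = 0 ∧ r.re < 0)
    {t : ℝ} (ht : 0 ≤ t) :
    ‖p.eval (t : ℂ)‖ ≤ ‖p.eval 0‖ * Real.exp (t * (p.roots.map fun r => (-r.re)⁻¹).sum) := by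
  rw [norm_eval_eq_mul_prod_roots hp ht, ← Multiset.sum_map_mul_left, Real.exp_multiset_sum,
    Multiset.map_map]
  gcongr
  refine Multiset.prod_map_le_prod_map₀ _ _ (fun r hr => ?_) fun r hr => ?_
  · have : 0 < (-r.re)⁻¹ := inv_pos.2 (by linarith [(hp r hr).2])
    positivity
  · rw [Function.comp_apply, add_comm]
    exact Real.add_one_le_exp _

theorem exp_sub_sq_le_one_add {y : ℝ} (hy : 0 ≤ y) : Real.exp (y - y ^ 2) ≤ 1 + y := by
  have h1 : 0 < 1 + y := by linarith
  rw [← Real.le_log_iff_exp_le h1]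
  refine le_trans ?_ (Real.one_sub_inv_le_log_of_pos h1)
  have : 1 - (1 + y)⁻¹ - (y - y ^ 2) = y ^ 3 / (1 + y) := by field_simp; ring
  have : 0 ≤ y ^ 3 / (1 + y) := by positivity
  linarith

open Polynomial in
/-- If the roots are real and at most `-b⁻¹`, the exponential bound is nearly attained at `1`. -/
theorem mul_exp_le_norm_eval_one {p : ℂ[X]} (hp : ∀ r ∈ p.roots, r.im = 0 ∧ r.re < 0) {b : ℝ}
    (hb : ∀ r ∈ p.roots, (-r.re)⁻¹ ≤ b) :
    ‖p.eval 0‖ * Real.exp ((p.roots.map fun r => (-r.re)⁻¹).sum - p.natDegree * b ^ 2)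
      ≤ ‖p.eval 1‖ := by
  have h1 := norm_eval_eq_mul_prod_roots hp (zero_le_one' ℝ)
  rw [Complex.ofReal_one] at h1
  rw [h1, (IsAlgClosed.splits p).natDegree_eq_card_roots]
  have hc : (p.roots.card : ℝ) * b ^ 2 = (p.roots.map fun _ => b ^ 2).sum := by simp
  rw [hc, ← Multiset.sum_map_sub, Real.exp_multiset_sum, Multiset.map_map]
  gcongr
  refine Multiset.prod_map_le_prod_map₀ _ _ (fun r hr => (Real.exp_pos _).le) fun r hr => ?_
  have hy : 0 < (-r.re)⁻¹ := inv_pos.2 (by linarith [(hp r hr).2])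
  rw [Function.comp_apply, one_mul]
  refine le_trans (Real.exp_le_exp.2 ?_) (exp_sub_sq_le_one_add hy.le)
  have := pow_le_pow_left₀ hy.le (hb r hr) 2
  linarith

/-- The permanent of the matrix whose first `m` rows are those of `M` and whose other rows are all
equal to `z`. -/
def mixedPerm {R : Type*} [CommSemiring R] {n : ℕ} (m : ℕ) (M : Matrix (Fin n) (Fin n) R)
    (z : Fin n → R) : R :=
  ∑ π : Equiv.Perm (Fin n), ∏ k : Fin n, if (k : ℕ) < m then M k (π k) else z (π k)

theorem map_mixedPerm {R S : Type*} [CommSemiring R] [CommSemiring S] {n : ℕ} (φ : R →+* S)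
    (m : ℕ) (M : Matrix (Fin n) (Fin n) R) (z : Fin n → R) :
    φ (mixedPerm m M z) = mixedPerm m (M.map φ) fun j => φ (z j) := by
  simp only [mixedPerm, map_sum, map_prod, apply_ite φ, Matrix.map_apply]

theorem card_filter_not_lt (n m : ℕ) :
    (Finset.univ.filter fun k : Fin n => ¬ (k : ℕ) < m).card = n - m := by
  have h := Finset.card_filter_add_card_filter_not (s := (Finset.univ : Finset (Fin n)))
    (fun k : Fin n => (k : ℕ) < m)
  have h2 : (Finset.univ.filter fun k : Fin n => (k : ℕ) < m).card = min n m := by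
    rw [Fin.card_filter_val_lt]
  rw [h2, Finset.card_univ, Fintype.card_fin] at h
  omega

theorem mixedPerm_zero {R : Type*} [CommSemiring R] {n : ℕ} (M : Matrix (Fin n) (Fin n) R)
    (z : Fin n → R) :
    mixedPerm 0 M z = n.factorial * ∏ j, z j := by
  simp [mixedPerm, Equiv.prod_comp, Fintype.card_perm]

theorem mixedPerm_self {n : ℕ} (M : Matrix (Fin n) (Fin n) ℝ) (z : Fin n → ℝ) :
    mixedPerm n M z = permanent M := by
  simp [mixedPerm, permanent]

theorem mixedPerm_pos {n m : ℕ} {M : Matrix (Fin n) (Fin n) ℝ} (hM : ∀ i j, 0 < M i j)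
    {z : Fin n → ℝ} (hz : ∀ j, 0 < z j) : 0 < mixedPerm m M z := by
  refine Finset.sum_pos (fun π _ => Finset.prod_pos fun k _ => ?_) Finset.univ_nonempty
  split_ifs
  exacts [hM _ _, hz _]

open Polynomial in
/-- The restriction of the polynomial `mixedPerm m M` to the line through `z` in direction `c`. -/
def mixedPermLine {R : Type*} [CommRing R] {n : ℕ} (m : ℕ) (M : Matrix (Fin n) (Fin n) R)
    (z c : Fin n → R) : R[X] :=
  mixedPerm m (M.map C) fun j => C (z j) + X * C (c j)

theorem eval_mixedPermLine {R : Type*} [CommRing R] {n : ℕ} (m : ℕ)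
    (M : Matrix (Fin n) (Fin n) R) (z c : Fin n → R) (t : R) :
    (mixedPermLine m M z c).eval t = mixedPerm m M fun j => z j + t * c j := by
  rw [mixedPermLine, ← Polynomial.coe_evalRingHom, map_mixedPerm]
  congr 1
  · ext; simp
  · simp only [Polynomial.coe_evalRingHom, Polynomial.eval_add, Polynomial.eval_mul,
      Polynomial.eval_C, Polynomial.eval_X]

open Polynomial in
theorem derivative_mixedPermLine {R : Type*} [CommRing R] {n : ℕ} (m : Fin n)
    (M : Matrix (Fin n) (Fin n) R) (z : Fin n → R) :
    derivative (mixedPermLine m M z (M m))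
      = ((n - m : ℕ) : R[X]) * mixedPermLine (m + 1) M z (M m) := by
  set L : Fin n → R[X] := fun j => C (z j) + X * C (M m j) with hL
  set u : Fin n → Fin n → R[X] := fun k j => if k < m then C (M k j) else L j with hu
  have hf : mixedPermLine m M z (M m) = ∑ π : Equiv.Perm (Fin n), ∏ k, u k (π k) := by
    simp [mixedPermLine, mixedPerm, hu, hL]
  have hg : mixedPermLine (m + 1) M z (M m) = ∑ π : Equiv.Perm (Fin n),
      ∏ k, Function.update u m (fun j => C (M m j)) k (π k) := by
    refine Finset.sum_congr rfl fun π _ => Finset.prod_congr rfl fun k _ => ?_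
    rcases lt_trichotomy k m with h | rfl | h
    · have : (k : ℕ) < m + 1 := Nat.lt_succ_of_lt h
      simp [this, Function.update_of_ne h.ne, hu, h]
    · simp
    · have : ¬ (k : ℕ) < m + 1 := by have : (m : ℕ) < k := h; omega
      simp [this, Function.update_of_ne h.ne', hu, h.le.not_gt, hL]
  have hterm : ∀ k : Fin n, ∑ π : Equiv.Perm (Fin n),
      (∏ l ∈ Finset.univ.erase k, u l (π l)) * derivative (u k (π k))
        = if (k : ℕ) < m then 0 else mixedPermLine (m + 1) M z (M m) := by
    intro k
    split_ifs with hk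
    · have hk' : k < m := hk
      simp [hu, hk']
    · have hk' : ¬ k < m := hk
      have hd : ∀ π : Equiv.Perm (Fin n),
          (∏ l ∈ Finset.univ.erase k, u l (π l)) * derivative (u k (π k))
            = ∏ l, Function.update u k (fun j => C (M m j)) l (π l) := by
        intro π
        rw [← Finset.prod_erase_mul _ _ (Finset.mem_univ k)]
        congr 1
        · refine Finset.prod_congr rfl fun l hl => ?_
          rw [Function.update_of_ne (Finset.ne_of_mem_erase hl)]
        · simp [hu, hk', hL]
      rw [hg, ← Equiv.sum_comp (Equiv.mulRight (Equiv.swap k m))]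
      refine Finset.sum_congr rfl fun π _ => ?_
      rw [hd, ← Equiv.prod_comp (Equiv.swap k m)]
      refine Finset.prod_congr rfl fun l _ => ?_
      have hukm : u k = u m := by
        ext1 j
        simp [hu, hk']
      rw [Equiv.coe_mulRight, Equiv.Perm.mul_apply, Equiv.swap_apply_self]
      rcases eq_or_ne l m with rfl | hlm
      · simp
      · rw [Function.update_of_ne hlm]
        rcases eq_or_ne l k with rfl | hlk
        · rw [Equiv.swap_apply_left, Function.update_of_ne hlm.symm, hukm]
        · rw [Equiv.swap_apply_of_ne_of_ne hlk hlm, Function.update_of_ne hlk]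
  rw [hf, derivative_sum]
  simp only [derivative_prod_finset]
  rw [Finset.sum_comm, Finset.sum_congr rfl fun k _ => hterm k, Finset.sum_ite,
    Finset.sum_const_zero, zero_add, Finset.sum_const, card_filter_not_lt, nsmul_eq_mul]

open Polynomial in
theorem natDegree_mixedPermLine_le {R : Type*} [CommRing R] {n : ℕ} (m : ℕ)
    (M : Matrix (Fin n) (Fin n) R) (z c : Fin n → R) :
    (mixedPermLine m M z c).natDegree ≤ n - m := by
  refine natDegree_sum_le_of_forall_le _ _ fun π _ => (natDegree_prod_le _ _).trans ?_
  rw [← card_filter_not_lt, Finset.card_filter]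
  refine Finset.sum_le_sum fun k _ => ?_
  by_cases hk : (k : ℕ) < m
  · simp [hk]
  · simp only [hk, if_false, not_false_eq_true, if_true]
    compute_degree

open Polynomial in
theorem coeff_mixedPermLine {R : Type*} [CommRing R] {n : ℕ} (m : ℕ)
    (M : Matrix (Fin n) (Fin n) R) (z c : Fin n → R) :
    (mixedPermLine m M z c).coeff (n - m) = mixedPerm m M c := by
  rw [mixedPermLine, mixedPerm, mixedPerm, finsetSum_coeff]
  refine Finset.sum_congr rfl fun π _ => ?_
  simp only [Matrix.map_apply]
  rw [Finset.prod_ite, Finset.prod_ite, ← map_prod, coeff_C_mul]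
  congr 1
  have h := coeff_prod_of_natDegree_le (Finset.univ.filter fun k : Fin n => ¬ (k : ℕ) < m)
    (fun k => C (z (π k)) + X * C (c (π k))) 1 (fun k _ => by compute_degree)
  rw [card_filter_not_lt, mul_one] at h
  rw [h]
  exact Finset.prod_congr rfl fun k _ => by simp [coeff_C]

theorem ofReal_mixedPerm {n m : ℕ} (M : Matrix (Fin n) (Fin n) ℝ) (z : Fin n → ℝ) :
    ((mixedPerm m M z : ℝ) : ℂ) = mixedPerm m (M.map Complex.ofRealHom) fun j => (z j : ℂ) :=
  map_mixedPerm Complex.ofRealHom m M z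

theorem coeff_mixedPermLine_ofReal_ne_zero {n m : ℕ} {M : Matrix (Fin n) (Fin n) ℝ}
    (hM : ∀ i j, 0 < M i j) (z : Fin n → ℂ) {c : Fin n → ℝ} (hc : ∀ j, 0 < c j) :
    (mixedPermLine m (M.map Complex.ofRealHom) z fun j => (c j : ℂ)).coeff (n - m) ≠ 0 := by
  rw [coeff_mixedPermLine, ← ofReal_mixedPerm]
  exact_mod_cast (mixedPerm_pos hM hc).ne'

/-- For positive `M`, the polynomial `mixedPerm m M` is stable. -/
theorem mixedPerm_ne_zero_of_im_pos {n : ℕ} {M : Matrix (Fin n) (Fin n) ℝ}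
    (hM : ∀ i j, 0 < M i j) {m : ℕ} (hm : m ≤ n) {z : Fin n → ℂ} (hz : ∀ j, 0 < (z j).im) :
    mixedPerm m (M.map Complex.ofRealHom) z ≠ 0 := by
  induction m generalizing z with
  | zero =>
    rw [mixedPerm_zero]
    refine mul_ne_zero (by exact_mod_cast n.factorial_ne_zero) (Finset.prod_ne_zero_iff.2 ?_)
    rintro j - h
    simpa [h] using hz j
  | succ m ih =>
    set k : Fin n := ⟨m, hm⟩
    have hcoeff := coeff_mixedPermLine_ofReal_ne_zero (m := m) hM z (hM k)
    have hd := eval_zero_derivative_ne_zero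
      (p := mixedPermLine m (M.map Complex.ofRealHom) z (M.map Complex.ofRealHom k))
      ((Nat.sub_pos_of_lt hm).trans_le (Polynomial.le_natDegree_of_ne_zero hcoeff)) fun t ht => by
        rw [eval_mixedPermLine]
        refine ih (by omega) fun j => ?_
        have : 0 ≤ t.im * M k j := mul_nonneg ht (hM k j).le
        simpa using add_pos_of_pos_of_nonneg (hz j) this
    have h := derivative_mixedPermLine k (M.map Complex.ofRealHom) z
    rw [h, Polynomial.eval_mul, eval_mixedPermLine] at hd
    simpa using right_ne_zero_of_mul hd

theorem roots_mixedPermLine {n m : ℕ} {M : Matrix (Fin n) (Fin n) ℝ} (hM : ∀ i j, 0 < M i j)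
    (hm : m ≤ n) {v c : Fin n → ℝ} (hc : ∀ j, 0 < c j) {b : ℝ} (hb : 0 < b)
    (hcv : ∀ j, c j ≤ b * v j) {r : ℂ}
    (hr : r ∈ (mixedPermLine m (M.map Complex.ofRealHom) (fun j => (v j : ℂ))
      fun j => (c j : ℂ)).roots) : r.im = 0 ∧ r.re ≤ -b⁻¹ := by
  have h0 := Polynomial.isRoot_of_mem_roots hr
  rw [Polynomial.IsRoot, eval_mixedPermLine] at h0
  have him : r.im = 0 := by
    rcases lt_trichotomy r.im 0 with h | h | h
    · have h1 := congrArg (starRingEnd ℂ) h0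
      rw [map_mixedPerm, map_zero] at h1
      have hMc : (M.map Complex.ofRealHom).map (starRingEnd ℂ) = M.map Complex.ofRealHom := by
        ext; simp
      rw [hMc] at h1
      refine absurd h1 (mixedPerm_ne_zero_of_im_pos hM hm fun j => ?_)
      simpa using mul_neg_of_neg_of_pos h (hc j)
    · exact h
    · refine absurd h0 (mixedPerm_ne_zero_of_im_pos hM hm fun j => ?_)
      simpa using mul_pos h (hc j)
  refine ⟨him, ?_⟩
  by_contra! hlt
  have hr' : r = (r.re : ℂ) := Complex.ext rfl (by simpa using him)
  rw [hr'] at h0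
  have h1 : mixedPerm m M (fun j => v j + r.re * c j) = 0 := by
    have := ofReal_mixedPerm (m := m) M fun j => v j + r.re * c j
    push_cast at this
    rw [h0] at this
    exact_mod_cast this
  refine (mixedPerm_pos hM fun j => ?_).ne' h1
  have h2 : b⁻¹ * c j ≤ v j := by
    rw [inv_mul_le_iff₀ hb]
    exact hcv j
  have h3 := mul_lt_mul_of_pos_right hlt (hc j)
  linarith

theorem norm_eval_mixedPermLine {n m : ℕ} {M : Matrix (Fin n) (Fin n) ℝ}
    (hM : ∀ i j, 0 < M i j) {v c : Fin n → ℝ} (hv : ∀ j, 0 < v j) (hc : ∀ j, 0 < c j) {t : ℝ}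
    (ht : 0 ≤ t) :
    ‖(mixedPermLine m (M.map Complex.ofRealHom) (fun j => (v j : ℂ))
      fun j => (c j : ℂ)).eval (t : ℂ)‖ = mixedPerm m M fun j => v j + t * c j := by
  have := ofReal_mixedPerm (m := m) M fun j => v j + t * c j
  push_cast at this
  rw [eval_mixedPermLine, ← this, Complex.norm_real, Real.norm_of_nonneg]
  refine (mixedPerm_pos hM fun j => ?_).le
  have := mul_nonneg ht (hc j).le
  linarith [hv j]

theorem sum_inv_roots_mixedPermLine {n : ℕ} {M : Matrix (Fin n) (Fin n) ℝ}
    (hM : ∀ i j, 0 < M i j) (m : Fin n) {v : Fin n → ℝ} (hv : ∀ j, 0 < v j)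
    (hr : ∀ r ∈ (mixedPermLine m (M.map Complex.ofRealHom) (fun j => (v j : ℂ))
      fun j => (M m j : ℂ)).roots, r.im = 0 ∧ r.re < 0) :
    ((mixedPermLine m (M.map Complex.ofRealHom) (fun j => (v j : ℂ))
      fun j => (M m j : ℂ)).roots.map fun r => (-r.re)⁻¹).sum * mixedPerm m M v
        = (n - m : ℕ) * mixedPerm (m + 1) M v := by
  set p := mixedPermLine m (M.map Complex.ofRealHom) (fun j => (v j : ℂ)) fun j => (M m j : ℂ)
    with hp
  have e0 : p.eval 0 = (mixedPerm m M v : ℝ) := by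
    rw [hp, eval_mixedPermLine, ofReal_mixedPerm]
    simp
  have h0 : p.eval 0 ≠ 0 := by
    rw [e0]
    exact_mod_cast (mixedPerm_pos hM hv).ne'
  have h1 : p.derivative.eval 0 = ((n - m : ℕ) * mixedPerm (m + 1) M v : ℝ) := by
    have h := derivative_mixedPermLine m (M.map Complex.ofRealHom) fun j => (v j : ℂ)
    have h' : p.derivative = _ := h
    rw [h', Polynomial.eval_mul, eval_mixedPermLine, Complex.ofReal_mul, ofReal_mixedPerm]
    simp
  have key := eval_zero_derivative_div_eval h0 hr
  rw [div_eq_iff h0, h1, e0] at key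
  exact_mod_cast key.symm

theorem mixedPerm_add_mul_le {n : ℕ} {M : Matrix (Fin n) (Fin n) ℝ}
    (hM : ∀ i j, 0 < M i j) (m : Fin n) {v : Fin n → ℝ} (hv : ∀ j, 0 < v j) {t : ℝ}
    (ht : 0 ≤ t) :
    mixedPerm m M (fun j => v j + t * M m j)
      ≤ mixedPerm m M v
        * Real.exp (t * ((n - m : ℕ) * mixedPerm (m + 1) M v / mixedPerm m M v)) := by
  set b : ℝ := ∑ j, M m j / v j with hb
  have hq : ∀ j, 0 < M m j / v j := fun j => div_pos (hM m j) (hv j)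
  have hbpos : 0 < b := Finset.sum_pos (fun j _ => hq j) ⟨m, Finset.mem_univ m⟩
  have hcv : ∀ j, M m j ≤ b * v j := fun j => by
    rw [← div_le_iff₀ (hv j)]
    exact Finset.single_le_sum (f := fun j => M m j / v j) (fun i _ => (hq i).le)
      (Finset.mem_univ j)
  have hr : ∀ r ∈ (mixedPermLine m (M.map Complex.ofRealHom) (fun j => (v j : ℂ))
      fun j => (M m j : ℂ)).roots, r.im = 0 ∧ r.re < 0 := fun r h => by
    obtain ⟨h1, h2⟩ := roots_mixedPermLine hM m.2.le (hM m) hbpos hcv h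
    exact ⟨h1, h2.trans_lt (neg_lt_zero.2 (inv_pos.2 hbpos))⟩
  have h := norm_eval_le_mul_exp hr ht
  have e0 := norm_eval_mixedPermLine (m := m) hM hv (hM m) le_rfl
  simp only [Complex.ofReal_zero, zero_mul, add_zero] at e0
  rwa [norm_eval_mixedPermLine hM hv (hM m) ht, e0,
    ← mul_div_cancel_right₀ (Multiset.sum _) (mixedPerm_pos hM hv).ne',
    sum_inv_roots_mixedPermLine hM m hv hr] at h

theorem mixedPerm_mul_exp_le {n : ℕ} {M : Matrix (Fin n) (Fin n) ℝ}
    (hM : ∀ i j, 0 < M i j) (m : Fin n) {v : Fin n → ℝ} (hv : ∀ j, 0 < v j) {b : ℝ}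
    (hb : 0 < b) (hcv : ∀ j, M m j ≤ b * v j) :
    mixedPerm m M v * Real.exp ((n - m : ℕ) * mixedPerm (m + 1) M v / mixedPerm m M v
        - (n - m : ℕ) * b ^ 2)
      ≤ mixedPerm m M fun j => v j + M m j := by
  set p := mixedPermLine m (M.map Complex.ofRealHom) (fun j => (v j : ℂ)) fun j => (M m j : ℂ)
    with hp
  have hr' : ∀ r ∈ p.roots, r.im = 0 ∧ r.re ≤ -b⁻¹ := fun r h =>
    roots_mixedPermLine hM m.2.le (hM m) hb hcv h
  have hr : ∀ r ∈ p.roots, r.im = 0 ∧ r.re < 0 := fun r h =>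
    ⟨(hr' r h).1, (hr' r h).2.trans_lt (neg_lt_zero.2 (inv_pos.2 hb))⟩
  have h := mul_exp_le_norm_eval_one hr (b := b) fun r h =>
    inv_le_of_inv_le₀ hb (by linarith [(hr' r h).2])
  have e0 := norm_eval_mixedPermLine (m := m) hM hv (hM m) le_rfl
  have e1 := norm_eval_mixedPermLine (m := m) hM hv (hM m) zero_le_one
  simp only [Complex.ofReal_zero, Complex.ofReal_one, zero_mul, add_zero, one_mul] at e0 e1
  rw [e0, e1, ← mul_div_cancel_right₀ (Multiset.sum _) (mixedPerm_pos hM hv).ne',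
    sum_inv_roots_mixedPermLine hM m hv hr] at h
  refine le_trans ?_ h
  have hdeg : (p.natDegree : ℝ) ≤ (n - m : ℕ) := by
    exact_mod_cast natDegree_mixedPermLine_le _ _ _ _
  have := (mixedPerm_pos (m := m) hM hv).le
  gcongr

theorem div_exp_le_mixedPerm_succ {n : ℕ} {M : Matrix (Fin n) (Fin n) ℝ}
    (hM : ∀ i j, 0 < M i j) (m : Fin n) {v : Fin n → ℝ} (hv : ∀ j, 0 < v j) {κ : ℝ}
    (hκ : ∀ t, 0 < t → κ * t ≤ mixedPerm m M fun j => v j + t * M m j) :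
    κ / Real.exp 1 ≤ (n - m : ℕ) * mixedPerm (m + 1) M v := by
  have h0 := mixedPerm_pos (m := m) hM hv
  have h1 : 0 < ((n - m : ℕ) : ℝ) * mixedPerm (m + 1) M v :=
    mul_pos (by exact_mod_cast Nat.sub_pos_of_lt m.2) (mixedPerm_pos hM hv)
  set d := ((n - m : ℕ) : ℝ) * mixedPerm (m + 1) M v
  have ht : 0 < mixedPerm m M v / d := div_pos h0 h1
  have h := (hκ _ ht).trans (mixedPerm_add_mul_le hM m hv ht.le)
  have e : mixedPerm m M v / d * (d / mixedPerm m M v) = 1 := by field_simp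
  rw [e] at h
  rw [div_le_iff₀ (Real.exp_pos 1)]
  have e2 : κ * (mixedPerm m M v / d) = mixedPerm m M v * (κ / d) := by ring
  rw [e2] at h
  have h2 := le_of_mul_le_mul_left h h0
  rwa [div_le_iff₀ h1, mul_comm] at h2

theorem mixedPerm_succ_le {n : ℕ} {M : Matrix (Fin n) (Fin n) ℝ}
    (hM : ∀ i j, 0 < M i j) (m : Fin n) {v : Fin n → ℝ} (hv : ∀ j, 0 < v j) {b : ℝ}
    (hb : 0 < b) (hcv : ∀ j, M m j ≤ b * v j) :
    (n - m : ℕ) * mixedPerm (m + 1) M v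
      ≤ mixedPerm m M (fun j => v j + M m j) / Real.exp 1 * Real.exp ((n - m : ℕ) * b ^ 2) := by
  have h0 := mixedPerm_pos (m := m) hM hv
  have h := mixedPerm_mul_exp_le hM m hv hb hcv
  set d := ((n - m : ℕ) : ℝ) * mixedPerm (m + 1) M v
  have h1 : d / mixedPerm m M v ≤ Real.exp (d / mixedPerm m M v) / Real.exp 1 := by
    rw [← Real.exp_sub]
    linarith [Real.add_one_le_exp (d / mixedPerm m M v - 1)]
  calc d = mixedPerm m M v * (d / mixedPerm m M v) := by field_simp
    _ ≤ mixedPerm m M v * (Real.exp (d / mixedPerm m M v) / Real.exp 1) := by gcongr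
    _ = mixedPerm m M v * Real.exp (d / mixedPerm m M v - (n - m : ℕ) * b ^ 2) / Real.exp 1
        * Real.exp ((n - m : ℕ) * b ^ 2) := by
      rw [Real.exp_sub]
      field_simp
    _ ≤ _ := by gcongr

/-- The combination with weights `x` of the rows of `M` with index at least `m`, shifted by `1`
to keep it positive. -/
def tailRow {n : ℕ} (m : ℕ) (M : Matrix (Fin n) (Fin n) ℝ) (x : Fin n → ℝ) (j : Fin n) : ℝ :=
  (∑ k : Fin n, if m ≤ (k : ℕ) then x k * M k j else 0) + 1

theorem tailRow_pos {n m : ℕ} {M : Matrix (Fin n) (Fin n) ℝ} (hM : ∀ i j, 0 < M i j)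
    {x : Fin n → ℝ} (hx : ∀ k, 0 < x k) (j : Fin n) : 0 < tailRow m M x j := by
  refine add_pos_of_nonneg_of_pos (Finset.sum_nonneg fun k _ => ?_) one_pos
  split_ifs
  exacts [(mul_pos (hx k) (hM k j)).le, le_rfl]

theorem tailRow_eq_succ_add {n : ℕ} (m : Fin n) (M : Matrix (Fin n) (Fin n) ℝ)
    (x : Fin n → ℝ) (j : Fin n) : tailRow m M x j = tailRow (m + 1) M x j + x m * M m j := by
  have h : ∀ k : Fin n, (if (m : ℕ) ≤ k then x k * M k j else 0)
      = (if (m : ℕ) + 1 ≤ k then x k * M k j else 0) + if k = m then x m * M m j else 0 := by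
    intro k
    rcases lt_trichotomy k m with h | rfl | h
    · have h' : (k : ℕ) < m := h
      simp [h.ne, h'.not_ge, show ¬ (m : ℕ) + 1 ≤ k by omega]
    · simp
    · have h' : (m : ℕ) < k := h
      simp [h.ne', h'.le, show (m : ℕ) + 1 ≤ k by omega]
  rw [tailRow, tailRow, Finset.sum_congr rfl fun k _ => h k, Finset.sum_add_distrib]
  simp
  ring

theorem pow_mul_prod_le_prod_sum {n : ℕ} {M : Matrix (Fin n) (Fin n) ℝ}
    (hM : ∀ i j, 0 < M i j) (hrow : ∀ i, ∑ j, M i j = n) (hcol : ∀ j, ∑ i, M i j = n)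
    {x : Fin n → ℝ} (hx : ∀ k, 0 < x k) :
    (n : ℝ) ^ n * ∏ k, x k ≤ ∏ j, ∑ k, x k * M k j := by
  rcases n.eq_zero_or_pos with rfl | hn
  · simp
  have hn' : (0 : ℝ) < n := by exact_mod_cast hn
  have h : ∀ j, ∏ k, x k ^ (M k j / n) ≤ (∑ k, x k * M k j) / n := fun j => by
    refine (Real.geom_mean_le_arith_mean_weighted Finset.univ (fun k => M k j / n) x
      (fun k _ => (div_pos (hM k j) hn').le) ?_ fun k _ => (hx k).le).trans_eq ?_
    · rw [← Finset.sum_div, hcol, div_self hn'.ne']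
    · rw [Finset.sum_div]
      exact Finset.sum_congr rfl fun k _ => by ring
  have h2 := Finset.prod_le_prod (s := Finset.univ)
    (fun j _ => Finset.prod_nonneg fun k _ => Real.rpow_nonneg (hx k).le _) fun j _ => h j
  rw [Finset.prod_comm, Finset.prod_div_distrib, Finset.prod_const, Finset.card_univ,
    Fintype.card_fin, le_div_iff₀ (by positivity), mul_comm] at h2
  refine le_trans (le_of_eq ?_) h2
  congr 1
  refine Finset.prod_congr rfl fun k _ => ?_
  rw [← Real.rpow_sum_of_pos (hx k), ← Finset.sum_div, hrow, div_self hn'.ne', Real.rpow_one]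

theorem le_mixedPerm_tailRow {n : ℕ} {M : Matrix (Fin n) (Fin n) ℝ}
    (hM : ∀ i j, 0 < M i j) (hrow : ∀ i, ∑ j, M i j = n) (hcol : ∀ j, ∑ i, M i j = n)
    {m : ℕ} (hm : m ≤ n) {x : Fin n → ℝ} (hx : ∀ k, 0 < x k) :
    (n : ℝ) ^ n * (n - m).factorial / Real.exp 1 ^ m
        * ∏ k : Fin n, (if m ≤ (k : ℕ) then x k else 1)
      ≤ mixedPerm m M (tailRow m M x) := by
  induction m generalizing x with
  | zero =>
    rw [mixedPerm_zero]
    simp only [Nat.sub_zero, pow_zero, div_one, Nat.zero_le, if_true]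
    rw [mul_right_comm, mul_comm]
    gcongr
    refine (pow_mul_prod_le_prod_sum hM hrow hcol hx).trans ?_
    refine Finset.prod_le_prod (fun j _ => Finset.sum_nonneg fun k _ => ?_) fun j _ => ?_
    · exact (mul_pos (hx k) (hM k j)).le
    · simp [tailRow]
  | succ m ih =>
    set l : Fin n := ⟨m, hm⟩ with hl
    set κ := (n : ℝ) ^ n * (n - m).factorial / Real.exp 1 ^ m
        * ∏ k : Fin n, (if m + 1 ≤ (k : ℕ) then x k else 1) with hκ
    have hstep := div_exp_le_mixedPerm_succ hM l (tailRow_pos (m := m + 1) hM hx) (κ := κ)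
      fun t ht => by
        have hxt : ∀ k, 0 < Function.update x l t k := fun k => by
          rcases eq_or_ne k l with rfl | h
          · simpa using ht
          · simpa [Function.update_of_ne h] using hx k
        refine le_trans (le_of_eq ?_) ((ih (by omega) hxt).trans_eq ?_)
        · rw [hκ, mul_assoc]
          congr 1
          rw [← Finset.prod_erase_mul _ _ (Finset.mem_univ l),
            ← Finset.prod_erase_mul (Finset.univ : Finset (Fin n))
              (fun k : Fin n => if m ≤ (k : ℕ) then Function.update x l t k else 1)
              (Finset.mem_univ l)]
          simp only [hl, Nat.not_succ_le_self, if_false, mul_one, le_refl, if_true,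
            Function.update_self]
          congr 1
          refine Finset.prod_congr rfl fun k hk => ?_
          have hkl := Finset.ne_of_mem_erase hk
          rw [Function.update_of_ne hkl]
          have hkm : (k : ℕ) ≠ m := fun h => hkl (Fin.ext h)
          exact if_congr (by omega) rfl rfl
        · congr 1
          ext j
          have h := tailRow_eq_succ_add l M (Function.update x l t) j
          rw [Function.update_self] at h
          refine h.trans ?_
          simp only [tailRow, hl]
          congr 2
          refine Finset.sum_congr rfl fun k _ => ?_
          split_ifs with hk
          · have hkl : k ≠ l := by rintro rfl; simp [hl] at hk
            rw [Function.update_of_ne hkl]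
          · rfl
    have hpos : (0 : ℝ) < (n - m : ℕ) := by exact_mod_cast Nat.sub_pos_of_lt hm
    rw [show (l : ℕ) = m from rfl] at hstep
    refine le_of_mul_le_mul_left (le_trans (le_of_eq ?_) hstep) hpos
    have hf : (n - m).factorial = (n - m) * (n - (m + 1)).factorial :=
      (Nat.mul_factorial_pred (by omega)).symm
    rw [hκ, hf]
    push_cast
    field_simp
    ring

theorem mixedPerm_tailRow_le {n : ℕ} {M : Matrix (Fin n) (Fin n) ℝ} {lam : ℝ}
    (hlam : 1 < lam) (hbd : ∀ i j, lam⁻¹ ≤ M i j ∧ M i j ≤ lam)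
    (hcol : ∀ j, ∑ i, M i j = n) {m : ℕ} (hm : m ≤ n) :
    mixedPerm m M (tailRow m M 1)
      ≤ ((n : ℝ) + 1) ^ n * (n - m).factorial / Real.exp 1 ^ m
        * Real.exp (lam ^ 4 * ∑ k ∈ Finset.range m, ((n - k : ℕ) : ℝ)⁻¹) := by
  have hlam0 : 0 < lam := one_pos.trans hlam
  have hM : ∀ i j, 0 < M i j := fun i j => (inv_pos.2 hlam0).trans_le (hbd i j).1
  induction m with
  | zero =>
    rw [mixedPerm_zero]
    simp [tailRow, hcol, mul_comm]
  | succ m ih =>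
    set l : Fin n := ⟨m, hm⟩ with hl
    have hpos : (0 : ℝ) < (n - m : ℕ) := by exact_mod_cast Nat.sub_pos_of_lt hm
    have hv : ∀ j, 0 < tailRow (m + 1) M 1 j := tailRow_pos hM fun _ => one_pos
    have hlow : ∀ j, ((n - m : ℕ) : ℝ) / lam ≤ tailRow (m + 1) M 1 j := fun j => by
      have h1 : ∑ k : Fin n, (if m + 1 ≤ (k : ℕ) then lam⁻¹ else 0)
          ≤ ∑ k : Fin n, if m + 1 ≤ (k : ℕ) then (1 : Fin n → ℝ) k * M k j else 0 := by
        refine Finset.sum_le_sum fun k _ => ?_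
        split_ifs
        · simpa using (hbd k j).1
        · rfl
      have h2 : ∑ k : Fin n, (if m + 1 ≤ (k : ℕ) then lam⁻¹ else 0)
          = (n - (m + 1) : ℕ) * lam⁻¹ := by
        rw [← Finset.sum_filter, Finset.sum_const, nsmul_eq_mul, ← card_filter_not_lt]
        simp only [not_lt]
      have h3 : ((n - m : ℕ) : ℝ) = (n - (m + 1) : ℕ) + 1 := by
        exact_mod_cast (show n - m = n - (m + 1) + 1 by omega)
      rw [h3, add_div, div_eq_mul_inv, tailRow]
      have h4 : 1 / lam ≤ 1 := by rw [div_le_one hlam0]; exact hlam.le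
      linarith
    have hb : 0 < lam ^ 2 / (n - m : ℕ) := by positivity
    have hcv : ∀ j, M l j ≤ lam ^ 2 / (n - m : ℕ) * tailRow (m + 1) M 1 j := fun j => by
      refine (hbd l j).2.trans (le_trans (le_of_eq ?_)
        (mul_le_mul_of_nonneg_left (hlow j) hb.le))
      field_simp
    have hstep := mixedPerm_succ_le hM l hv hb hcv
    have htail : (fun j => tailRow (m + 1) M 1 j + M l j) = tailRow m M 1 := by
      ext j
      simpa using (tailRow_eq_succ_add l M 1 j).symm
    have hexp : ((n - m : ℕ) : ℝ) * (lam ^ 2 / (n - m : ℕ)) ^ 2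
        = lam ^ 4 * ((n - m : ℕ) : ℝ)⁻¹ := by
      field_simp
    rw [htail] at hstep
    refine le_of_mul_le_mul_left (hstep.trans ?_) hpos
    have hf : (n - m).factorial = (n - m) * (n - (m + 1)).factorial :=
      (Nat.mul_factorial_pred (by omega)).symm
    have hih := ih (by omega)
    rw [hf] at hih
    rw [show (l : ℕ) = m from rfl, hexp, Finset.sum_range_succ, mul_add, Real.exp_add]
    refine (mul_le_mul_of_nonneg_right (div_le_div_of_nonneg_right hih (Real.exp_pos 1).le)
      (Real.exp_pos _).le).trans_eq ?_
    push_cast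
    field_simp
    ring

theorem pow_div_exp_le_permanent {n : ℕ} {M : Matrix (Fin n) (Fin n) ℝ}
    (hM : ∀ i j, 0 < M i j) (hrow : ∀ i, ∑ j, M i j = n) (hcol : ∀ j, ∑ i, M i j = n) :
    (n : ℝ) ^ n / Real.exp 1 ^ n ≤ permanent M := by
  have h := le_mixedPerm_tailRow hM hrow hcol le_rfl (x := 1) fun _ => one_pos
  rw [mixedPerm_self] at h
  simpa using h

theorem sum_range_inv_sub (n : ℕ) :
    ∑ k ∈ Finset.range n, ((n - k : ℕ) : ℝ)⁻¹ ≤ 1 + Real.log n := by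
  have h := harmonic_le_one_add_log n
  rw [harmonic, ← Finset.sum_range_reflect] at h
  push_cast at h
  refine le_trans (le_of_eq (Finset.sum_congr rfl fun k hk => ?_)) h
  have hk' := Finset.mem_range.1 hk
  rw [show n - k = n - 1 - k + 1 by omega]
  push_cast
  rfl

theorem permanent_le {n : ℕ} {M : Matrix (Fin n) (Fin n) ℝ} {lam : ℝ} (hlam : 1 < lam)
    (hbd : ∀ i j, lam⁻¹ ≤ M i j ∧ M i j ≤ lam) (hcol : ∀ j, ∑ i, M i j = n) :
    permanent M ≤ ((n : ℝ) + 1) ^ n / Real.exp 1 ^ n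
      * Real.exp (lam ^ 4 * (1 + Real.log n)) := by
  have h := mixedPerm_tailRow_le hlam hbd hcol le_rfl
  rw [mixedPerm_self] at h
  simp only [Nat.sub_self, Nat.factorial_zero, Nat.cast_one, mul_one] at h
  refine h.trans ?_
  gcongr
  exact sum_range_inv_sub n

theorem factorial_le_mul_pow {n : ℕ} (hn : n ≠ 0) :
    (n.factorial : ℝ) ≤ Real.exp 1 * n * ((n : ℝ) ^ n / Real.exp 1 ^ n) := by
  obtain ⟨k, rfl⟩ := Nat.exists_eq_succ_of_ne_zero hn
  have h : Stirling.stirlingSeq (k + 1) ≤ Stirling.stirlingSeq 1 :=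
    Stirling.stirlingSeq'_antitone (Nat.zero_le k)
  set N := k + 1
  have hN : (1 : ℝ) ≤ N := by exact_mod_cast Nat.succ_le_succ (Nat.zero_le k)
  have hN0 : (0 : ℝ) < N := by linarith
  rw [Stirling.stirlingSeq_one, Stirling.stirlingSeq, div_le_iff₀ (by positivity),
    Real.sqrt_mul (by norm_num), div_pow] at h
  have hs : √(N : ℝ) ≤ N := by
    rw [Real.sqrt_le_left hN0.le]
    nlinarith
  calc (N.factorial : ℝ) ≤ Real.exp 1 / √2 * (√2 * √N * (N ^ N / Real.exp 1 ^ N)) := h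
    _ = Real.exp 1 * √N * (N ^ N / Real.exp 1 ^ N) := by field_simp
    _ ≤ _ := by gcongr

theorem pow_div_exp_le_factorial (n : ℕ) : (n : ℝ) ^ n / Real.exp 1 ^ n ≤ n.factorial := by
  have h := Real.pow_div_factorial_le_exp (n : ℝ) n.cast_nonneg n
  rw [div_le_iff₀ (by positivity)] at h
  rwa [← Real.exp_nat_mul, mul_one, div_le_iff₀ (Real.exp_pos _), mul_comm]

theorem exp_neg_le_permanent_div_factorial {n : ℕ} (hn : n ≠ 0) {M : Matrix (Fin n) (Fin n) ℝ}
    (hM : ∀ i j, 0 < M i j) (hrow : ∀ i, ∑ j, M i j = n) (hcol : ∀ j, ∑ i, M i j = n) :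
    Real.exp (-(1 + Real.log n)) ≤ permanent M / n.factorial := by
  have hn0 : (0 : ℝ) < n := by exact_mod_cast Nat.pos_of_ne_zero hn
  rw [Real.exp_neg, Real.exp_add, Real.exp_log hn0, le_div_iff₀ (by positivity),
    inv_mul_le_iff₀ (by positivity)]
  refine (factorial_le_mul_pow hn).trans ?_
  gcongr
  exact pow_div_exp_le_permanent hM hrow hcol

theorem permanent_div_factorial_le_exp {n : ℕ} (hn : n ≠ 0) {M : Matrix (Fin n) (Fin n) ℝ}
    {lam : ℝ} (hlam : 1 < lam) (hbd : ∀ i j, lam⁻¹ ≤ M i j ∧ M i j ≤ lam)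
    (hcol : ∀ j, ∑ i, M i j = n) :
    permanent M / n.factorial ≤ Real.exp (1 + lam ^ 4 * (1 + Real.log n)) := by
  have hn0 : (0 : ℝ) < n := by exact_mod_cast Nat.pos_of_ne_zero hn
  have h1 : ((n : ℝ) + 1) ^ n ≤ Real.exp 1 * (n : ℝ) ^ n := by
    have h := pow_le_pow_left₀ (by positivity) (Real.add_one_le_exp ((n : ℝ)⁻¹)) n
    rw [← Real.exp_nat_mul, mul_inv_cancel₀ hn0.ne'] at h
    calc ((n : ℝ) + 1) ^ n = ((n : ℝ)⁻¹ + 1) ^ n * (n : ℝ) ^ n := by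
          rw [← mul_pow]
          congr 1
          field_simp
          ring
      _ ≤ _ := by gcongr
  rw [div_le_iff₀ (by positivity), Real.exp_add]
  refine (permanent_le hlam hbd hcol).trans ?_
  calc _ ≤ Real.exp 1 * (n : ℝ) ^ n / Real.exp 1 ^ n
        * Real.exp (lam ^ 4 * (1 + Real.log n)) := by gcongr
    _ = Real.exp 1 * Real.exp (lam ^ 4 * (1 + Real.log n))
        * ((n : ℝ) ^ n / Real.exp 1 ^ n) := by ring
    _ ≤ _ := by
      gcongr
      exact pow_div_exp_le_factorial n

theorem tendsto_exp_affine_log_mul_inv (a b : ℝ) :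
    Tendsto (fun n : ℕ => Real.exp ((a + b * Real.log n) * (n : ℝ)⁻¹)) atTop (nhds 1) := by
  have h1 : Tendsto (fun n : ℕ => (n : ℝ)⁻¹) atTop (nhds 0) :=
    tendsto_inv_atTop_zero.comp tendsto_natCast_atTop_atTop
  have h2 : Tendsto (fun n : ℕ => Real.log n * (n : ℝ)⁻¹) atTop (nhds 0) := by
    have := (Real.isLittleO_log_id_atTop.tendsto_div_nhds_zero).comp
      (tendsto_natCast_atTop_atTop (R := ℝ))
    simpa [Function.comp_def, div_eq_mul_inv] using this
  have h3 := (h1.const_mul a).add (h2.const_mul b)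
  rw [mul_zero, mul_zero, add_zero] at h3
  have h4 := (Real.continuous_exp.tendsto 0).comp h3
  rw [Real.exp_zero] at h4
  refine h4.congr fun n => ?_
  simp only [Function.comp_apply]
  ring_nf

/-- permanental mean of matrices in `n·Ω_n` with entries in `[λ⁻¹, λ]`
tends to `1`. -/
theorem permMean_tendsto_one (lam : ℝ) (hlam : 1 < lam)
    (A : (n : ℕ) → Matrix (Fin n) (Fin n) ℝ)
    (hbd : ∀ n i j, lam⁻¹ ≤ A n i j ∧ A n i j ≤ lam)
    (hrow : ∀ n i, ∑ j, A n i j = n) (hcol : ∀ n j, ∑ i, A n i j = n) :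
    Tendsto (fun n : ℕ => permMean (A n)) atTop (nhds 1) := by
  have hM : ∀ n i j, 0 < A n i j := fun n i j =>
    (inv_pos.2 (one_pos.trans hlam)).trans_le (hbd n i j).1
  refine tendsto_of_tendsto_of_tendsto_of_le_of_le'
    (tendsto_exp_affine_log_mul_inv (-1) (-1))
    (tendsto_exp_affine_log_mul_inv (1 + lam ^ 4) (lam ^ 4)) ?_ ?_
  · filter_upwards [eventually_ne_atTop 0] with n hn
    rw [Real.exp_mul, permMean]
    refine Real.rpow_le_rpow (Real.exp_pos _).le ?_ (by positivity)
    refine le_trans (le_of_eq ?_)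
      (exp_neg_le_permanent_div_factorial hn (hM n) (hrow n) (hcol n))
    congr 1
    ring
  · filter_upwards [eventually_ne_atTop 0] with n hn
    rw [Real.exp_mul, permMean]
    refine Real.rpow_le_rpow ?_ ?_ (by positivity)
    · exact (Real.exp_pos _).le.trans
        (exp_neg_le_permanent_div_factorial hn (hM n) (hrow n) (hcol n))
    · refine (permanent_div_factorial_le_exp hn hlam (hbd n) (hcol n)).trans_eq ?_
      congr 1
      ring
end
end
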